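/- arXiv:2404.05263 — 2 statements merged into one kernel-verified Lean document; each statement's English description precedes it below -/
import Mathlib

section
/- For every c ∈ ℝ and all k, m, n ∈ ℕ, one has D_{-m,k,n+m+k+1}(c) = (-1)^{binom(m+k+1,2)} · D_{m,k,n}(c), i.e. det(a_{i+j-m,k}(c))_{i,j=0}^{n+m+k} = (-1)^{binom(m+k+1,2)} · det(a_{i+j+m,k}(c))_{i,j=0}^{n-1}. -/
/-- The Catalan-like array `a_{n,k}(s)` for natural indices. -/
def catA (s : ℕ → ℝ) : ℕ → ℕ → ℝ
  | 0, k => if k = 0 then 1 else 0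
  | n + 1, k => (if k = 0 then 0 else catA s n (k - 1)) + s k * catA s n k + catA s n (k + 1)

/-- The array extended to integer indices, vanishing for `n < 0` or `k < 0`. -/
def catAZ (s : ℕ → ℝ) (n k : ℤ) : ℝ :=
  if 0 ≤ n ∧ 0 ≤ k then catA s n.toNat k.toNat else 0

/-- Hankel determinant `D_{m,k,n}(s) = det (a_{i+j+m,k}(s))_{i,j=0}^{n-1}`. -/
def hankelD (s : ℕ → ℝ) (m : ℤ) (k n : ℕ) : ℝ :=
  Matrix.det (Matrix.of fun i j : Fin n => catAZ s ((i : ℤ) + (j : ℤ) + m) (k : ℤ))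

open PowerSeries Finset

/-- The determinant of the exchange matrix. -/
theorem det_exchange_matrix {R : Type*} [CommRing R] (n : ℕ) :
    (Matrix.of fun i j : Fin n => if (i : ℕ) + j + 1 = n then (1 : R) else 0).det =
      (-1) ^ n.choose 2 := by
  induction n with
  | zero => simp
  | succ n ih =>
    rw [Matrix.det_succ_row_zero, Finset.sum_eq_single (Fin.last n)]
    · have hsub : (Matrix.of fun i j : Fin (n + 1) =>
          if (i : ℕ) + j + 1 = n + 1 then (1 : R) else 0).submatrix Fin.succ
            (Fin.last n).succAbove =
          Matrix.of fun i j : Fin n => if (i : ℕ) + j + 1 = n then (1 : R) else 0 := by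
        ext i j
        simp only [Matrix.submatrix_apply, Matrix.of_apply, Fin.succAbove_last, Fin.val_succ,
          Fin.val_castSucc]
        congr 1
        simp only [eq_iff_iff]
        omega
      rw [hsub, ih, Nat.choose_succ_succ' n 1, Nat.choose_one_right, pow_add]
      simp
    · intro j _ hj
      have : (j : ℕ) ≠ n := fun h => hj (Fin.ext (by simpa using h))
      simp [this]
    · simp

/-- Splitting the convolution defining `coeff (i + j) (B * G)` at index `j`. -/
theorem sum_coeff_shift_mul_add {R : Type*} [CommRing R] (B G : R⟦X⟧) (i j : ℕ) :
    ∑ l ∈ range (i + 1), coeff (i - l) G * coeff (l + j) B =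
      coeff (i + j) (B * G) - ∑ p ∈ range j, coeff (i + j - p) G * coeff p B := by
  rw [coeff_mul, Finset.Nat.sum_antidiagonal_eq_sum_range_succ
    (fun a b => coeff a B * coeff b G), show (i + j).succ = j + (i + 1) by omega,
    Finset.sum_range_add _ j]
  simp only [mul_comm (coeff _ G)]
  rw [add_sub_cancel_left]
  refine Finset.sum_congr rfl fun l _ => ?_
  rw [show i + j - (j + l) = i - l by omega, add_comm j l]

/-- A sum over `Fin M` supported on an initial segment. -/
theorem sum_fin_ite_le_mul {R : Type*} [CommRing R] {M i : ℕ} (hi : i < M) (f g : ℕ → R) :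
    ∑ l : Fin M, (if (l : ℕ) ≤ i then f l else 0) * g l =
      ∑ l ∈ range (i + 1), f l * g l := by
  rw [Fin.sum_univ_eq_sum_range (fun l => (if l ≤ i then f l else 0) * g l) M]
  simp only [ite_mul, zero_mul]
  rw [← Finset.sum_filter]
  refine Finset.sum_congr ?_ fun _ _ => rfl
  ext l
  simp only [mem_filter, mem_range]
  omega

/-- The determinant of a lower unitriangular Toeplitz matrix. -/
theorem det_lower_toeplitz {R : Type*} [CommRing R] (G : R⟦X⟧) (hG : coeff 0 G = 1) (M : ℕ) :
    (Matrix.of fun i l : Fin M =>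
      if (l : ℕ) ≤ i then coeff ((i : ℕ) - l) G else 0).det = 1 := by
  rw [Matrix.det_of_isLowerTriangular]
  · simp [hG]
  · intro i j hij
    have : (i : ℕ) < j := hij
    rw [Matrix.of_apply, if_neg this.not_ge]

/-- Hankel determinants of `X ^ N * F` are, up to sign, shifted Hankel determinants of the
inverse series of `F`. -/
theorem det_hankel_X_pow_mul {R : Type*} [CommRing R] (F G : R⟦X⟧) (hFG : F * G = 1)
    (hF : coeff 0 F = 1) (hG : coeff 0 G = 1) (N n : ℕ) :
    (Matrix.of fun i j : Fin (N + 1 + n) => coeff ((i : ℕ) + j) (X ^ N * F)).det =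
      (-1) ^ (N + 1).choose 2 *
        (Matrix.of fun i j : Fin n => -coeff ((i : ℕ) + j + (N + 2)) G).det := by
  set H := Matrix.of fun i j : Fin (N + 1 + n) => coeff ((i : ℕ) + j) (X ^ N * F) with hH
  set T := Matrix.of fun i l : Fin (N + 1 + n) =>
    if (l : ℕ) ≤ i then coeff ((i : ℕ) - l) G else 0 with hT
  set K := Matrix.of fun i j : Fin n => -coeff ((i : ℕ) + j + (N + 2)) G with hK
  set U := Matrix.of fun i l : Fin n =>
    if (l : ℕ) ≤ i then coeff ((i : ℕ) - l) F else 0 with hU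
  have hTH (i j : Fin (N + 1 + n)) : (T * H) i j = (if (i : ℕ) + j = N then 1 else 0) -
      ∑ p ∈ range j, coeff ((i : ℕ) + j - p) G * coeff p (X ^ N * F) := by
    rw [Matrix.mul_apply]
    simp only [hT, hH, Matrix.of_apply]
    rw [sum_fin_ite_le_mul i.2 (fun l => coeff ((i : ℕ) - l) G)
      (fun l => coeff (l + (j : ℕ)) (X ^ N * F)), sum_coeff_shift_mul_add, mul_assoc, hFG,
      mul_one, coeff_X_pow]
  have hleft (i j : Fin (N + 1 + n)) (hj : (j : ℕ) ≤ N) :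
      (T * H) i j = if (i : ℕ) + j = N then 1 else 0 := by
    rw [hTH, sub_eq_self]
    refine Finset.sum_eq_zero fun p hp => ?_
    rw [mem_range] at hp
    rw [coeff_X_pow_mul', if_neg (by omega), mul_zero]
  have hblock : (T * H).submatrix finSumFinEquiv finSumFinEquiv = Matrix.fromBlocks
      (Matrix.of fun i j : Fin (N + 1) => if (i : ℕ) + j + 1 = N + 1 then (1 : R) else 0)
      (Matrix.of fun i j => (T * H) (Fin.castAdd n i) (Fin.natAdd (N + 1) j))
      0 (K * U.transpose) := by
    ext i j
    rcases i with i | i <;> rcases j with j | j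
    · simp only [Matrix.submatrix_apply, finSumFinEquiv_apply_left, Matrix.fromBlocks_apply₁₁,
        Matrix.of_apply]
      rw [hleft _ _ (by simp; omega)]
      simp
    · simp
    · simp only [Matrix.submatrix_apply, finSumFinEquiv_apply_left, finSumFinEquiv_apply_right,
        Matrix.fromBlocks_apply₂₁, Matrix.zero_apply]
      rw [hleft _ _ (by simp; omega), if_neg (by simp; omega)]
    · simp only [Matrix.submatrix_apply, finSumFinEquiv_apply_right, Matrix.fromBlocks_apply₂₂]
      rw [hTH, if_neg (by simp; omega), zero_sub, Matrix.mul_apply]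
      simp only [hK, hU, Matrix.of_apply, Matrix.transpose_apply, Fin.val_natAdd]
      simp only [mul_comm (-coeff _ G)]
      rw [sum_fin_ite_le_mul j.2 (fun l => coeff ((j : ℕ) - l) F)
        (fun l => -coeff ((i : ℕ) + l + (N + 2)) G),
        show N + 1 + (j : ℕ) = N + (j + 1) by omega, Finset.sum_range_add,
        Finset.sum_eq_zero (s := range N), zero_add, ← Finset.sum_range_reflect,
        ← Finset.sum_neg_distrib]
      · refine Finset.sum_congr rfl fun p hp => ?_
        rw [mem_range] at hp
        rw [coeff_X_pow_mul', if_pos (by omega), mul_neg, mul_comm]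
        congr 4 <;> omega
      · intro p hp
        rw [mem_range] at hp
        rw [coeff_X_pow_mul', if_neg (by omega), mul_zero]
  calc H.det = (T * H).det := by
        rw [Matrix.det_mul, hT, det_lower_toeplitz G hG, one_mul]
    _ = (-1) ^ (N + 1).choose 2 * K.det := by
        rw [← Matrix.det_submatrix_equiv_self finSumFinEquiv, hblock,
          Matrix.det_fromBlocks_zero₂₁, det_exchange_matrix, Matrix.det_mul,
          Matrix.det_transpose, hU, det_lower_toeplitz F hF, mul_one]

/-- The generating function of the `k`-th column of the array with constant weights. -/
noncomputable def catColumn (c : ℝ) (k : ℕ) : ℝ⟦X⟧ := PowerSeries.mk fun n => catA (fun _ => c) n k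

theorem catColumn_zero_eq (c : ℝ) :
    catColumn c 0 = 1 + X * (C c * catColumn c 0 + catColumn c 1) := by
  ext n
  cases n with
  | zero => simp [catColumn, catA]
  | succ n => simp [catColumn, catA, coeff_one, coeff_succ_X_mul]

theorem catColumn_succ_eq (c : ℝ) (k : ℕ) :
    catColumn c (k + 1) =
      X * (catColumn c k + C c * catColumn c (k + 1) + catColumn c (k + 2)) := by
  ext n
  cases n with
  | zero => simp [catColumn, catA]
  | succ n => simp [catColumn, catA, coeff_succ_X_mul]

/-- A family of power series satisfying the homogeneous three-term relations vanishes. -/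
theorem eq_zero_of_three_term (c : ℝ) (D : ℕ → ℝ⟦X⟧)
    (h0 : D 0 = X * (C c * D 0 + D 1))
    (hs : ∀ k, D (k + 1) = X * (D k + C c * D (k + 1) + D (k + 2))) (k : ℕ) : D k = 0 := by
  have key (n : ℕ) : ∀ k, coeff n (D k) = 0 := by
    induction n with
    | zero =>
      rintro (_ | k)
      · rw [h0]; simp
      · rw [hs]; simp
    | succ n ih =>
      rintro (_ | k)
      · rw [h0]; simp [coeff_succ_X_mul, ih]
      · rw [hs]; simp [coeff_succ_X_mul, ih]
  ext n
  simp [key]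

theorem catColumn_succ (c : ℝ) (k : ℕ) :
    catColumn c (k + 1) = X * catColumn c 0 * catColumn c k := by
  refine sub_eq_zero.mp (eq_zero_of_three_term c
    (fun k => catColumn c (k + 1) - X * catColumn c 0 * catColumn c k) ?_ (fun k => ?_) k)
  · linear_combination catColumn_succ_eq c 0 - X * catColumn c 0 * catColumn_zero_eq c
  · linear_combination catColumn_succ_eq c (k + 1) - X * catColumn c 0 * catColumn_succ_eq c k

theorem catColumn_eq (c : ℝ) (k : ℕ) : catColumn c k = X ^ k * catColumn c 0 ^ (k + 1) := by
  induction k with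
  | zero => simp
  | succ k ih => rw [catColumn_succ, ih]; ring

/-- The inverse of the generating function of the zeroth column. -/
noncomputable def catInv (c : ℝ) : ℝ⟦X⟧ := 1 - C c * X - X ^ 2 * catColumn c 0

theorem catColumn_zero_mul_catInv (c : ℝ) : catColumn c 0 * catInv c = 1 := by
  rw [catInv]
  linear_combination catColumn_zero_eq c + X * catColumn_succ c 0

/-- `catInv c ^ j + X ^ (2 * j) * catColumn c 0 ^ j` is a polynomial of degree at most `j`. -/
theorem coeff_catInv_pow_add (c : ℝ) (j l : ℕ) (hl : j < l) :
    coeff l (catInv c ^ j + X ^ (2 * j) * catColumn c 0 ^ j) = 0 := by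
  induction j using Nat.twoStepInduction generalizing l with
  | zero => simp [coeff_one, hl.ne']
  | one =>
    obtain ⟨l, rfl⟩ := Nat.exists_eq_add_of_lt hl
    have : catInv c ^ 1 + X ^ (2 * 1) * catColumn c 0 ^ 1 = 1 - X * C c := by
      rw [catInv]; ring
    rw [this, show 1 + l + 1 = (l + 1) + 1 by omega, map_sub, coeff_succ_X_mul]
    simp [coeff_one]
  | more j ih1 ih2 =>
    obtain ⟨l, rfl⟩ := Nat.exists_eq_add_of_le (show 2 ≤ l by omega)
    have : catInv c ^ (j + 2) + X ^ (2 * (j + 2)) * catColumn c 0 ^ (j + 2) =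
        (catInv c ^ (j + 1) + X ^ (2 * (j + 1)) * catColumn c 0 ^ (j + 1)) -
        X * (C c * (catInv c ^ (j + 1) + X ^ (2 * (j + 1)) * catColumn c 0 ^ (j + 1))) -
        X * (X * (catInv c ^ j + X ^ (2 * j) * catColumn c 0 ^ j)) := by
      have hsum : catInv c + X ^ 2 * catColumn c 0 = 1 - C c * X := by rw [catInv]; ring
      linear_combination (catInv c ^ (j + 1) + X ^ (2 * (j + 1)) * catColumn c 0 ^ (j + 1)) * hsum
        - X ^ 2 * (catInv c ^ j + X ^ (2 * j) * catColumn c 0 ^ j) * catColumn_zero_mul_catInv c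
    rw [this, show 2 + l = (l + 1) + 1 by omega, map_sub, map_sub, coeff_succ_X_mul,
      coeff_succ_X_mul, coeff_succ_X_mul, coeff_C_mul, ih2 _ (by omega), ih2 _ (by omega),
      ih1 _ (by omega)]
    simp

theorem neg_coeff_catInv_pow (c : ℝ) (k l : ℕ) :
    -coeff (l + (k + 2)) (catInv c ^ (k + 1)) = catA (fun _ => c) l k := by
  have h := coeff_catInv_pow_add c (k + 1) (l + (k + 2)) (by omega)
  rw [map_add, show X ^ (2 * (k + 1)) * catColumn c 0 ^ (k + 1) = X ^ (k + 2) * catColumn c k by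
    rw [catColumn_eq c k]; ring, coeff_X_pow_mul] at h
  have hc : coeff l (catColumn c k) = catA (fun _ => c) l k := by simp [catColumn]
  linarith

theorem catAZ_eq_coeff (c : ℝ) (k m l : ℕ) :
    catAZ (fun _ => c) ((l : ℤ) + -(m : ℤ)) k =
      coeff l (X ^ (m + k) * catColumn c 0 ^ (k + 1)) := by
  rw [pow_add, mul_assoc, ← catColumn_eq, coeff_X_pow_mul', catAZ]
  by_cases h : m ≤ l
  · rw [if_pos h, if_pos (by omega), show ((l : ℤ) + -(m : ℤ)).toNat = l - m by omega]
    simp [catColumn]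
  · rw [if_neg h, if_neg (by omega)]

/-- Theorem 2, main identity:
`D_{-m,k,n+m+k+1}(c) = (-1)^{C(m+k+1,2)} D_{m,k,n}(c)`. -/
theorem backward_hankel_const_eq (c : ℝ) (k m n : ℕ) :
    hankelD (fun _ => c) (-(m : ℤ)) k (n + m + k + 1) =
      (-1 : ℝ) ^ Nat.choose (m + k + 1) 2 * hankelD (fun _ => c) (m : ℤ) k n := by
  have hcol : constantCoeff (catColumn c 0) = 1 := by
    rw [← coeff_zero_eq_constantCoeff_apply]; simp [catColumn, catA]
  have hinv : constantCoeff (catInv c) = 1 := by simp [catInv]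
  have key := det_hankel_X_pow_mul (catColumn c 0 ^ (k + 1)) (catInv c ^ (k + 1))
    (by rw [← mul_pow, catColumn_zero_mul_catInv, one_pow]) (by simp [hcol]) (by simp [hinv])
    (m + k) n
  rw [show n + m + k + 1 = m + k + 1 + n by omega, hankelD, hankelD]
  convert key using 3
  · ext i j
    exact_mod_cast catAZ_eq_coeff c k m (i + j)
  · congr 1
    funext i j
    rw [show (i : ℕ) + j + (m + k + 2) = (i + j + m) + (k + 2) by omega, neg_coeff_catInv_pow,
      catAZ, if_pos (by omega)]
    congr 1
end

section
/- For every c ∈ ℝ and all k, n ∈ ℕ such that k + 1 does not divide n, the unshifted Hankel determinant at height k vanishes: D_{0,k,n}(c) = 0. -/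
open Polynomial

/-- The shifted Vieta–Fibonacci polynomials; `vietaFib c (k + 1)` is the `k`-th orthogonal
polynomial for the moment sequence `catA (fun _ => c) n 0`. -/
noncomputable def vietaFib (c : ℝ) : ℕ → ℝ[X]
  | 0 => 0
  | 1 => 1
  | n + 2 => (X - C c) * vietaFib c (n + 1) - vietaFib c n

theorem vietaFib_add_add_one (c : ℝ) (m n : ℕ) :
    vietaFib c (m + n + 1) =
      vietaFib c (m + 1) * vietaFib c (n + 1) - vietaFib c m * vietaFib c n := by
  induction n using Nat.twoStepInduction with
  | zero => simp [vietaFib]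
  | one => simp [vietaFib]; ring
  | more n ih₁ ih₂ =>
    rw [show m + (n + 2) + 1 = (m + n + 1) + 2 by ring, vietaFib, ih₁,
      show m + n + 1 + 1 = m + (n + 1) + 1 by ring, ih₂]
    simp only [vietaFib]
    ring

theorem vietaFib_dvd_mul (c : ℝ) (k m : ℕ) : vietaFib c (k + 1) ∣ vietaFib c ((k + 1) * m) := by
  induction m with
  | zero => simp [vietaFib]
  | succ m ih =>
    rw [show (k + 1) * (m + 1) = (k + 1) * m + k + 1 by ring, vietaFib_add_add_one]
    exact dvd_sub (dvd_mul_left _ _) (ih.mul_right _)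

theorem degree_vietaFib_succ (c : ℝ) (n : ℕ) : (vietaFib c (n + 1)).degree = n := by
  induction n using Nat.twoStepInduction with
  | zero => simp [vietaFib]
  | one => simp [vietaFib]
  | more n ih₁ ih₂ =>
    have hdeg : ((X - C c) * vietaFib c (n + 2)).degree = ((n + 2 : ℕ) : WithBot ℕ) := by
      rw [degree_mul, degree_X_sub_C, ih₂]
      norm_cast
      ring
    rw [vietaFib, degree_sub_eq_left_of_degree_lt, hdeg]
    rw [hdeg, ih₁]
    exact_mod_cast (by lia : n < n + 2)

/-- The linear functional on polynomials with moments `catA s n 0`. -/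
noncomputable def catMoment (s : ℕ → ℝ) : ℝ[X] →ₗ[ℝ] ℝ :=
  lsum fun n => LinearMap.mulRight ℝ (catA s n 0)

theorem catMoment_X_pow (s : ℕ → ℝ) (n : ℕ) : catMoment s (X ^ n) = catA s n 0 := by
  simp [catMoment, lsum_apply, X_pow_eq_monomial, sum_monomial_index]

theorem catMoment_X_pow_mul_vietaFib (c : ℝ) (k n : ℕ) :
    catMoment (fun _ => c) (X ^ n * vietaFib c (k + 1)) = catA (fun _ => c) n k := by
  have hstep (n : ℕ) (p r : ℝ[X]) : catMoment (fun _ => c) (X ^ n * ((X - C c) * p - r)) =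
      catMoment (fun _ => c) (X ^ (n + 1) * p) - c * catMoment (fun _ => c) (X ^ n * p) -
        catMoment (fun _ => c) (X ^ n * r) := by
    rw [← smul_eq_mul c, ← map_smul, ← map_sub, ← map_sub, smul_eq_C_mul]
    ring_nf
  induction k using Nat.twoStepInduction generalizing n with
  | zero => simp [vietaFib, catMoment_X_pow]
  | one =>
    rw [vietaFib, hstep]
    simp [vietaFib, catMoment_X_pow, catA]
  | more k ih₁ ih₂ =>
    rw [vietaFib, hstep, ih₁, ih₂, ih₂]
    simp [catA]
    ring

theorem catA_eq_zero_of_lt (s : ℕ → ℝ) {n k : ℕ} (h : n < k) : catA s n k = 0 := by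
  induction n generalizing k with
  | zero => simp [catA, h.ne']
  | succ n ih =>
    simp [catA, ih (show n < k - 1 by lia), ih (show n < k by lia), ih (show n < k + 1 by lia)]

theorem hankelD_zero_eq_zero_of_polynomial (c : ℝ) {k n : ℕ} {q : ℝ[X]} (hq : q ≠ 0)
    (hdeg : q.natDegree < n)
    (horth : ∀ j < n, catMoment (fun _ => c) (X ^ j * (q * vietaFib c (k + 1))) = 0) :
    hankelD (fun _ => c) 0 k n = 0 := by
  refine Matrix.exists_mulVec_eq_zero_iff.mp ⟨fun i : Fin n => q.coeff i, fun h => ?_, ?_⟩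
  · exact hq (leadingCoeff_eq_zero.mp (congrFun h ⟨q.natDegree, hdeg⟩))
  · ext j
    have hentry (i : Fin n) : catAZ (fun _ => c) ((j : ℤ) + (i : ℤ) + 0) k =
        catA (fun _ => c) (j + i) k := by
      rw [catAZ, if_pos (by lia)]
      congr 1
    have hsum : X ^ (j : ℕ) * (q * vietaFib c (k + 1)) =
        ∑ i : Fin n, q.coeff i • (X ^ (j + i : ℕ) * vietaFib c (k + 1)) := by
      conv_lhs => rw [q.as_sum_range' n hdeg]
      rw [Finset.sum_mul, Finset.mul_sum, Finset.sum_range]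
      refine Finset.sum_congr rfl fun i _ => ?_
      rw [← C_mul_X_pow_eq_monomial, smul_eq_C_mul]
      ring
    rw [Pi.zero_apply, ← horth j j.isLt, hsum, map_sum, Matrix.mulVec, dotProduct]
    refine Finset.sum_congr rfl fun i _ => ?_
    rw [map_smul, catMoment_X_pow_mul_vietaFib, smul_eq_mul, mul_comm, Matrix.of_apply, hentry]

/-- Corollary, second part: `D_{0,k,n}(c) = 0` whenever `k + 1` does not divide `n`. -/
theorem hankel_const_vanishes (c : ℝ) (k n : ℕ) (h : ¬ (k + 1) ∣ n) :
    hankelD (fun _ => c) 0 k n = 0 := by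
  have hmod : n % (k + 1) ≠ 0 := fun h0 => h (Nat.dvd_of_mod_eq_zero h0)
  have hlt : n % (k + 1) < k + 1 := Nat.mod_lt _ k.succ_pos
  have hdiv := Nat.div_add_mod n (k + 1)
  set d := (k + 1) * (n / (k + 1)) with hd
  obtain ⟨q, hq⟩ := vietaFib_dvd_mul c k (n / (k + 1) + 1)
  rw [mul_add_one, ← hd, ← add_assoc] at hq
  have hdeg := congrArg degree hq
  rw [degree_mul, degree_vietaFib_succ, degree_vietaFib_succ] at hdeg
  have hq0 : q ≠ 0 := by
    rintro rfl
    simp at hdeg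
  rw [degree_eq_natDegree hq0] at hdeg
  norm_cast at hdeg
  refine hankelD_zero_eq_zero_of_polynomial c hq0 (by lia) fun j hj => ?_
  rw [mul_comm q, ← hq, catMoment_X_pow_mul_vietaFib, catA_eq_zero_of_lt _ (by lia)]
end
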